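/- arXiv:2204.10637 — 2 statements merged into one kernel-verified Lean document; each statement's English description precedes it below -/
import Mathlib

section
/- Let k be a commutative ring, A a commutative k-algebra, J ⊆ A an ideal, and f ∈ J². Let B be a localization of A⊗_k A in which the diagonal ideal I·B is generated by a regular sequence θ₁, …, θ_d, and suppose b₁, …, b_d ∈ B satisfy 1⊗f − f⊗1 = Σ_{i=1}^d b_i θ_i in B. Then b_i ∈ I·B + (A⊗J)·B for every i = 1, …, d. -/
open TensorProduct

/-- `θ 0, θ 1, …, θ (d-1)` is a regular sequence in `B`: each `θ i` is a nonzerodivisor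
modulo the ideal generated by the previous ones. -/
def IsRegSeq {B : Type*} [CommRing B] {d : ℕ} (θ : Fin d → B) : Prop :=
  ∀ i : Fin d, ∀ b : B,
    θ i * b ∈ Ideal.span (θ '' {j : Fin d | j < i}) →
      b ∈ Ideal.span (θ '' {j : Fin d | j < i})

theorem IsRegSeq.comp_castSucc {B : Type*} [CommRing B] {n : ℕ} {θ : Fin (n + 1) → B}
    (h : IsRegSeq θ) : IsRegSeq (fun i : Fin n => θ i.castSucc) := by
  intro i b hb
  have himage : (fun j : Fin n => θ j.castSucc) '' {j | j < i} =
      θ '' {j | j < i.castSucc} := by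
    ext x
    constructor
    · rintro ⟨j, hj, rfl⟩
      exact ⟨j.castSucc, Fin.castSucc_lt_castSucc_iff.2 hj, rfl⟩
    · rintro ⟨j, hj, rfl⟩
      have hj' : (j : ℕ) < i := hj
      exact ⟨⟨j, hj'.trans i.isLt⟩, hj', rfl⟩
  rw [himage] at hb ⊢
  exact h i.castSucc b hb

/-- The coefficients of a linear relation among the members of a regular sequence lie in the
ideal generated by the sequence. -/
theorem IsRegSeq.mem_span_range_of_sum_eq_zero {B : Type*} [CommRing B] {d : ℕ}
    {θ : Fin d → B} (h : IsRegSeq θ) {a : Fin d → B} (ha : ∑ i, a i * θ i = 0) (i : Fin d) :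
    a i ∈ Ideal.span (Set.range θ) := by
  induction d with
  | zero => exact i.elim0
  | succ n ih =>
    have himage : θ '' {j | j < Fin.last n} = Set.range (fun j : Fin n => θ j.castSucc) := by
      ext x
      constructor
      · rintro ⟨j, hj, rfl⟩
        exact ⟨⟨j, hj⟩, rfl⟩
      · rintro ⟨j, rfl⟩
        exact ⟨j.castSucc, Fin.castSucc_lt_last j, rfl⟩
    have hsub : Ideal.span (Set.range (fun j : Fin n => θ j.castSucc)) ≤
        Ideal.span (Set.range θ) :=
      Ideal.span_mono (Set.range_comp_subset_range Fin.castSucc θ)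
    rw [Fin.sum_univ_castSucc] at ha
    have hlast : a (Fin.last n) ∈ Ideal.span (Set.range (fun j : Fin n => θ j.castSucc)) := by
      rw [← himage]
      apply h
      rw [himage, show θ (Fin.last n) * a (Fin.last n) =
        -∑ j : Fin n, a j.castSucc * θ j.castSucc by linear_combination ha]
      exact neg_mem (Ideal.sum_mem _ fun j _ =>
        Ideal.mul_mem_left _ _ (Ideal.subset_span ⟨j, rfl⟩))
    obtain ⟨e, he⟩ := Ideal.mem_span_range_iff_exists_fun.1 hlast
    have hrel : ∑ j : Fin n, (a j.castSucc + e j * θ (Fin.last n)) * θ j.castSucc = 0 := by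
      rw [← he, Finset.sum_mul] at ha
      rw [← ha, ← Finset.sum_add_distrib]
      exact Finset.sum_congr rfl fun j _ => by ring
    refine Fin.lastCases (hsub hlast) (fun j => ?_) i
    have hj := hsub (ih h.comp_castSucc hrel j)
    exact (Ideal.add_mem_iff_left _
      (Ideal.mul_mem_left _ (e j) (Ideal.subset_span (Set.mem_range_self (Fin.last n))))).1 hj

/-- If `∑ bᵢ θᵢ` lies in `K * (θ)` for a regular sequence `θ` contained in `K`, then every `bᵢ`
lies in `K`. -/
theorem IsRegSeq.mem_of_sum_mem_mul_span {B : Type*} [CommRing B] {d : ℕ} {θ : Fin d → B}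
    (h : IsRegSeq θ) {K : Ideal B} (hK : Ideal.span (Set.range θ) ≤ K) {b : Fin d → B}
    (hb : ∑ i, b i * θ i ∈ K * Ideal.span (Set.range θ)) (i : Fin d) : b i ∈ K := by
  obtain ⟨c, hc, hsum⟩ := (Submodule.mem_ideal_smul_span_iff_exists_sum K θ _).1 hb
  rw [Finsupp.sum_fintype _ _ (by simp)] at hsum
  have hrel : ∑ j, (b j - c j) * θ j = 0 := by
    simp only [sub_mul, Finset.sum_sub_distrib]
    rw [← hsum]
    simp
  have hi := hK (h.mem_span_range_of_sum_eq_zero hrel i)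
  simpa using K.add_mem hi (hc i)

theorem one_tmul_sub_tmul_one_mem_ker_lmul' (k : Type*) {A : Type*} [CommRing k] [CommRing A]
    [Algebra k A] (a : A) :
    (1 : A) ⊗ₜ[k] a - a ⊗ₜ[k] (1 : A) ∈
      RingHom.ker (Algebra.TensorProduct.lmul' k (S := A) : A ⊗[k] A →ₐ[k] A) := by
  simp [RingHom.mem_ker]

theorem one_tmul_sub_tmul_one_mem_mul_ker_lmul' (k : Type*) {A : Type*} [CommRing k]
    [CommRing A] [Algebra k A] {J : Ideal A} {f : A} (hf : f ∈ J ^ 2) :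
    (1 : A) ⊗ₜ[k] f - f ⊗ₜ[k] (1 : A) ∈
      (RingHom.ker (Algebra.TensorProduct.lmul' k (S := A) : A ⊗[k] A →ₐ[k] A) +
        Ideal.span {x : A ⊗[k] A | ∃ g ∈ J, x = (1 : A) ⊗ₜ[k] g}) *
      RingHom.ker (Algebra.TensorProduct.lmul' k (S := A) : A ⊗[k] A →ₐ[k] A) := by
  rw [pow_two] at hf
  induction hf using Submodule.mul_induction_on' with
  | mem_mul_mem g hg h hh =>
    have hgI := one_tmul_sub_tmul_one_mem_ker_lmul' k g
    have hhI := one_tmul_sub_tmul_one_mem_ker_lmul' k h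
    have hright : ∀ a ∈ J, (1 : A) ⊗ₜ[k] a ∈
        RingHom.ker (Algebra.TensorProduct.lmul' k (S := A) : A ⊗[k] A →ₐ[k] A) +
          Ideal.span {x : A ⊗[k] A | ∃ g ∈ J, x = (1 : A) ⊗ₜ[k] g} := fun a ha =>
      Ideal.mem_sup_right (Ideal.subset_span ⟨a, ha, rfl⟩)
    have hleft : h ⊗ₜ[k] (1 : A) ∈
        RingHom.ker (Algebra.TensorProduct.lmul' k (S := A) : A ⊗[k] A →ₐ[k] A) +
          Ideal.span {x : A ⊗[k] A | ∃ g ∈ J, x = (1 : A) ⊗ₜ[k] g} := by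
      simpa using sub_mem (hright h hh) (Ideal.mem_sup_left hhI)
    have hmul : (1 : A) ⊗ₜ[k] (g * h) - (g * h) ⊗ₜ[k] (1 : A) =
        ((1 : A) ⊗ₜ[k] g) * ((1 : A) ⊗ₜ[k] h - h ⊗ₜ[k] (1 : A)) +
          (h ⊗ₜ[k] (1 : A)) * ((1 : A) ⊗ₜ[k] g - g ⊗ₜ[k] (1 : A)) := by
      simp [mul_sub, mul_comm]
    rw [hmul]
    exact add_mem (Ideal.mul_mem_mul (hright g hg) hhI) (Ideal.mul_mem_mul hleft hgI)
  | add x _ y _ hx hy =>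
    rw [TensorProduct.tmul_add, TensorProduct.add_tmul, add_sub_add_comm]
    exact add_mem hx hy

/-!
STATEMENT 9.
Let `k` be a commutative ring, `A` a commutative `k`-algebra, `J ⊆ A` an ideal, and `f ∈ J²`.
Let `B` be a localization of `A ⊗_k A` in which the diagonal ideal `I·B` is generated by a
regular sequence `θ₁, …, θ_d`, and suppose `b₁, …, b_d ∈ B` satisfy
`1⊗f − f⊗1 = Σ_{i=1}^d b_i θ_i` in `B`.  Then `b_i ∈ I·B + (A⊗J)·B` for every `i`.
Here `I = ker(A ⊗_k A → A)` is the diagonal ideal and `A⊗J` is the ideal of `A ⊗_k A`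
generated by the elements `1⊗g`, `g ∈ J`.
-/
theorem stmt9 (k A : Type*) [CommRing k] [CommRing A] [Algebra k A]
    (J : Ideal A) (f : A) (hf : f ∈ J ^ 2)
    (M : Submonoid (A ⊗[k] A)) (B : Type*) [CommRing B] [Algebra (A ⊗[k] A) B]
    [IsLocalization M B]
    (d : ℕ) (θ : Fin d → B) (hreg : IsRegSeq θ)
    (hgen : Ideal.span (Set.range θ) =
      Ideal.map (algebraMap (A ⊗[k] A) B)
        (RingHom.ker (Algebra.TensorProduct.lmul' k (S := A) : A ⊗[k] A →ₐ[k] A)))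
    (b : Fin d → B)
    (hb : algebraMap (A ⊗[k] A) B ((1 : A) ⊗ₜ[k] f - f ⊗ₜ[k] (1 : A)) =
      ∑ i, b i * θ i) :
    ∀ i, b i ∈
      Ideal.map (algebraMap (A ⊗[k] A) B)
          (RingHom.ker (Algebra.TensorProduct.lmul' k (S := A) : A ⊗[k] A →ₐ[k] A)) +
        Ideal.map (algebraMap (A ⊗[k] A) B)
          (Ideal.span {x : A ⊗[k] A | ∃ g ∈ J, x = (1 : A) ⊗ₜ[k] g}) := by
  refine hreg.mem_of_sum_mem_mul_span (hgen.le.trans le_sup_left) ?_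
  rw [← hb, hgen]
  have hmem := Ideal.mem_map_of_mem (algebraMap (A ⊗[k] A) B)
    (one_tmul_sub_tmul_one_mem_mul_ker_lmul' k hf)
  rwa [Ideal.map_mul, Submodule.add_eq_sup, Ideal.map_sup] at hmem
end

section
/- Let k be a field, n ≥ 2 and d ≥ 1, and let C = k[t₁, …, t_d, τ₁, …, τ_d][((1 + t₁^{n-1}τ₁)(1 + n·t₁^{n-1}τ₁))^{-1}]. Then the k-algebra homomorphism k[z₁, …, z_d, y₁, …, y_d] → C determined by z_i ↦ t_i + τ_i t₁^n and y_i ↦ τ_i is étale. -/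
noncomputable section

variable (k : Type) [Field k] (n d : ℕ)

/-- The polynomial ring `k[t₁,…,t_d,τ₁,…,τ_d]`: `inl i ↦ t_i`, `inr i ↦ τ_i`. -/
abbrev PolyTT : Type := MvPolynomial (Fin d ⊕ Fin d) k

/-- The polynomial ring `k[z₁,…,z_d,y₁,…,y_d]`: `inl i ↦ z_i`, `inr i ↦ y_i`. -/
abbrev PolyZY : Type := MvPolynomial (Fin d ⊕ Fin d) k

variable (hd : 0 < d)

/-- `C = k[t₁,…,t_d,τ₁,…,τ_d][((1 + t₁^{n-1}τ₁)(1 + n·t₁^{n-1}τ₁))^{-1}]`. -/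
abbrev Cloc : Type :=
  Localization.Away
    (((1 : PolyTT k d) +
        MvPolynomial.X (Sum.inl (⟨0, hd⟩ : Fin d)) ^ (n - 1) *
          MvPolynomial.X (Sum.inr (⟨0, hd⟩ : Fin d))) *
      ((1 : PolyTT k d) +
        (n : PolyTT k d) *
          MvPolynomial.X (Sum.inl (⟨0, hd⟩ : Fin d)) ^ (n - 1) *
            MvPolynomial.X (Sum.inr (⟨0, hd⟩ : Fin d))))

/-- The `k`-algebra homomorphism `k[z₁,…,z_d,y₁,…,y_d] → C` determined by
`z_i ↦ t_i + τ_i·t₁^n` and `y_i ↦ τ_i`. -/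
def structHom : PolyZY k d →ₐ[k] Cloc k n d hd :=
  MvPolynomial.aeval (fun v =>
    match v with
    | Sum.inl i => algebraMap (PolyTT k d) (Cloc k n d hd)
        (MvPolynomial.X (Sum.inl i) +
          MvPolynomial.X (Sum.inr i) *
            MvPolynomial.X (Sum.inl (⟨0, hd⟩ : Fin d)) ^ n)
    | Sum.inr i => algebraMap (PolyTT k d) (Cloc k n d hd) (MvPolynomial.X (Sum.inr i)))

/-- An algebra generated by a root of `f` that is universal among the roots of `f` at which `g` is
invertible is formally étale as soon as `f'` is invertible at that root. -/
theorem Algebra.FormallyEtale.of_universal_simple_root {R S : Type} [CommRing R] [CommRing S]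
    [Algebra R S] (f g : Polynomial R) (x : S) (hf : Polynomial.aeval x f = 0)
    (hf' : IsUnit (Polynomial.aeval x f.derivative)) (hg : IsUnit (Polynomial.aeval x g))
    (hext : ∀ (B : Type) [CommRing B] [Algebra R B] (φ ψ : S →ₐ[R] B), φ x = ψ x → φ = ψ)
    (hlift : ∀ (B : Type) [CommRing B] [Algebra R B] (b : B), Polynomial.aeval b f = 0 →
      IsUnit (Polynomial.aeval b g) → ∃ φ : S →ₐ[R] B, φ x = b) :
    Algebra.FormallyEtale R S := by
  refine Algebra.FormallyEtale.iff_comp_bijective.mpr fun B _ _ I hI ↦ ⟨fun φ ψ h ↦ ?_, fun χ ↦ ?_⟩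
  · refine hext B φ ψ ?_
    have hmem : ψ x - φ x ∈ I := by
      rw [← Ideal.Quotient.mk_eq_mk_iff_sub_mem]
      exact (DFunLike.congr_fun h x).symm
    have hsq : (ψ x - φ x) ^ 2 = 0 := hI.le (Ideal.pow_mem_pow hmem 2)
    have hψ : Polynomial.aeval (φ x + (ψ x - φ x)) f = 0 := by
      rw [add_sub_cancel, Polynomial.aeval_algHom_apply, hf, map_zero]
    rw [Polynomial.aeval_add_of_sq_eq_zero _ _ _ hsq, Polynomial.aeval_algHom_apply,
      Polynomial.aeval_algHom_apply, hf, map_zero, zero_add] at hψ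
    exact (sub_eq_zero.mp ((hf'.map φ).mul_right_eq_zero.mp hψ)).symm
  · obtain ⟨b, hb⟩ := Ideal.Quotient.mk_surjective (χ x)
    have hmk (p : Polynomial R) :
        Ideal.Quotient.mk I (Polynomial.aeval b p) = χ (Polynomial.aeval x p) := by
      rw [← Polynomial.aeval_algHom_apply χ, ← hb]
      exact (Polynomial.aeval_algHom_apply (Ideal.Quotient.mkₐ R I) b p).symm
    have hunit (c : B) : IsUnit (Ideal.Quotient.mk I c) ↔ IsUnit c :=
      IsNilpotent.isUnit_quotient_mk_iff ⟨2, hI⟩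
    have hfI : Polynomial.aeval b f ∈ I := by
      rw [← Ideal.Quotient.eq_zero_iff_mem, hmk, hf, map_zero]
    obtain ⟨u, hu⟩ := ((hunit _).mp ((hmk f.derivative).symm ▸ hf'.map χ)).exists_right_inv
    have hεI : Polynomial.aeval b f * -u ∈ I := I.mul_mem_right _ hfI
    have hb' : Ideal.Quotient.mk I (b + Polynomial.aeval b f * -u) = χ x := by
      rw [map_add, hb, Ideal.Quotient.eq_zero_iff_mem.mpr hεI, add_zero]
    obtain ⟨φ, hφ⟩ := hlift B (b + Polynomial.aeval b f * -u)
      (by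
        rw [Polynomial.aeval_add_of_sq_eq_zero _ _ _ (hI.le (Ideal.pow_mem_pow hεI 2))]
        linear_combination -Polynomial.aeval b f * hu)
      (by
        rw [← hunit]
        have := Polynomial.aeval_algHom_apply (Ideal.Quotient.mkₐ R I)
          (b + Polynomial.aeval b f * -u) g
        simp only [Ideal.Quotient.mkₐ_eq_mk] at this
        rw [← this, hb', Polynomial.aeval_algHom_apply]
        exact hg.map χ)
    exact ⟨φ, hext _ _ _ (by rw [AlgHom.comp_apply, hφ]; exact hb')⟩

/-- The element `(1 + t₁^{n-1}τ₁)(1 + n·t₁^{n-1}τ₁)` that is inverted in `C`. -/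
abbrev clocDenom : PolyTT k d :=
  ((1 : PolyTT k d) +
      MvPolynomial.X (Sum.inl (⟨0, hd⟩ : Fin d)) ^ (n - 1) *
        MvPolynomial.X (Sum.inr (⟨0, hd⟩ : Fin d))) *
    ((1 : PolyTT k d) +
      (n : PolyTT k d) *
        MvPolynomial.X (Sum.inl (⟨0, hd⟩ : Fin d)) ^ (n - 1) *
          MvPolynomial.X (Sum.inr (⟨0, hd⟩ : Fin d)))

/-- The coordinate `t₁` in `C`. -/
def clocCoord : Cloc k n d hd :=
  algebraMap (PolyTT k d) (Cloc k n d hd) (MvPolynomial.X (Sum.inl ⟨0, hd⟩))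

theorem structHom_X_inl (i : Fin d) :
    structHom k n d hd (MvPolynomial.X (Sum.inl i)) =
      algebraMap (PolyTT k d) (Cloc k n d hd) (MvPolynomial.X (Sum.inl i)) +
        structHom k n d hd (MvPolynomial.X (Sum.inr i)) * clocCoord k n d hd ^ n := by
  simp [structHom, clocCoord]

theorem structHom_X_inr (i : Fin d) :
    structHom k n d hd (MvPolynomial.X (Sum.inr i)) =
      algebraMap (PolyTT k d) (Cloc k n d hd) (MvPolynomial.X (Sum.inr i)) := by
  simp [structHom]

theorem structHom_C (c : k) :
    structHom k n d hd (MvPolynomial.C c) =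
      algebraMap (PolyTT k d) (Cloc k n d hd) (MvPolynomial.C c) := by
  rw [← MvPolynomial.algebraMap_eq, AlgHom.commutes]
  exact IsScalarTower.algebraMap_apply k (PolyTT k d) (Cloc k n d hd) c

theorem cloc_ringHom_ext {B : Type} [CommRing B] {φ ψ : Cloc k n d hd →+* B}
    (h : ∀ p, φ (structHom k n d hd p) = ψ (structHom k n d hd p))
    (ht : φ (clocCoord k n d hd) = ψ (clocCoord k n d hd)) : φ = ψ := by
  refine IsLocalization.ringHom_ext (Submonoid.powers (clocDenom k n d hd)) (MvPolynomial.ringHom_ext ?_ ?_)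
  · intro c
    simpa only [structHom_C, RingHom.comp_apply] using h (MvPolynomial.C c)
  · rintro (i | i)
    · have hi := h (MvPolynomial.X (Sum.inl i))
      simp only [structHom_X_inl k n d hd i, map_add, map_mul, map_pow, ht, h] at hi
      exact add_right_cancel hi
    · simpa only [structHom_X_inr, RingHom.comp_apply] using h (MvPolynomial.X (Sum.inr i))

theorem exists_cloc_lift {B : Type} [CommRing B] (a : PolyZY k d →+* B) (b : B)
    (hb : b + a (MvPolynomial.X (Sum.inr ⟨0, hd⟩)) * b ^ n =
      a (MvPolynomial.X (Sum.inl ⟨0, hd⟩)))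
    (hu : IsUnit ((1 + b ^ (n - 1) * a (MvPolynomial.X (Sum.inr ⟨0, hd⟩))) *
      (1 + n * b ^ (n - 1) * a (MvPolynomial.X (Sum.inr ⟨0, hd⟩))))) :
    ∃ φ : Cloc k n d hd →+* B,
      (∀ p, φ (structHom k n d hd p) = a p) ∧ φ (clocCoord k n d hd) = b := by
  let ψ : PolyTT k d →+* B := MvPolynomial.eval₂Hom (a.comp MvPolynomial.C) (Sum.elim
    (fun i ↦ a (MvPolynomial.X (Sum.inl i)) - a (MvPolynomial.X (Sum.inr i)) * b ^ n)
    (fun i ↦ a (MvPolynomial.X (Sum.inr i))))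
  have hψt : ψ (MvPolynomial.X (Sum.inl ⟨0, hd⟩)) = b := by
    simp [ψ, ← hb]
  have hψτ (i : Fin d) : ψ (MvPolynomial.X (Sum.inr i)) = a (MvPolynomial.X (Sum.inr i)) := by
    simp [ψ]
  let φ : Cloc k n d hd →+* B := IsLocalization.Away.lift (g := ψ) (clocDenom k n d hd) (by
    simpa only [map_mul, map_add, map_one, map_pow, map_natCast, hψt, hψτ] using hu)
  have hφ (p : PolyTT k d) : φ (algebraMap (PolyTT k d) (Cloc k n d hd) p) = ψ p :=
    IsLocalization.Away.lift_eq _ _ p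
  have ht : φ (clocCoord k n d hd) = b := (hφ _).trans hψt
  refine ⟨φ, fun p ↦ ?_, ht⟩
  suffices φ.comp (structHom k n d hd).toRingHom = a from DFunLike.congr_fun this p
  refine MvPolynomial.ringHom_ext (fun c ↦ ?_) ?_
  · change φ (structHom k n d hd (MvPolynomial.C c)) = _
    rw [structHom_C, hφ]
    simp [ψ]
  · rintro (i | i)
    · change φ (structHom k n d hd (MvPolynomial.X (Sum.inl i))) = _
      rw [structHom_X_inl, map_add, map_mul, map_pow, ht, structHom_X_inr, hφ, hφ, hψτ]
      simp [ψ]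
    · change φ (structHom k n d hd (MvPolynomial.X (Sum.inr i))) = _
      rw [structHom_X_inr, hφ, hψτ]

theorem isUnit_cloc_denominators :
    IsUnit ((1 + clocCoord k n d hd ^ (n - 1) *
        structHom k n d hd (MvPolynomial.X (Sum.inr ⟨0, hd⟩))) *
      (1 + n * clocCoord k n d hd ^ (n - 1) *
        structHom k n d hd (MvPolynomial.X (Sum.inr ⟨0, hd⟩)))) := by
  have h := IsLocalization.Away.algebraMap_isUnit (S := Cloc k n d hd) (clocDenom k n d hd)
  simpa only [map_mul, map_add, map_one, map_pow, map_natCast, clocCoord, structHom_X_inr] using h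

theorem structHom_formallyEtale : (structHom k n d hd).toRingHom.FormallyEtale := by
  let : Algebra (PolyZY k d) (Cloc k n d hd) := (structHom k n d hd).toRingHom.toAlgebra
  have halg (p : PolyZY k d) :
      algebraMap (PolyZY k d) (Cloc k n d hd) p = structHom k n d hd p := rfl
  let y : PolyZY k d := MvPolynomial.X (Sum.inr ⟨0, hd⟩)
  let z : PolyZY k d := MvPolynomial.X (Sum.inl ⟨0, hd⟩)
  have hunit := isUnit_cloc_denominators k n d hd
  refine Algebra.FormallyEtale.of_universal_simple_root
    (.X + .C y * .X ^ n - .C z)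
    ((1 + .X ^ (n - 1) * .C y) * (1 + n * .X ^ (n - 1) * .C y)) (clocCoord k n d hd)
    ?_ ?_ ?_ ?_ ?_
  · simp only [map_sub, map_add, map_mul, map_pow, Polynomial.aeval_X, Polynomial.aeval_C]
    rw [halg, halg, structHom_X_inl, sub_eq_zero]
    rfl
  · refine (congrArg IsUnit ?_).mp (isUnit_of_mul_isUnit_right hunit)
    simp only [Polynomial.derivative_X,
      Polynomial.derivative_C_mul, Polynomial.derivative_X_pow, Polynomial.derivative_C,
      map_sub, map_add, map_mul, map_pow, map_one, map_zero, map_natCast, Polynomial.aeval_X,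
      Polynomial.aeval_C, halg, y]
    ring
  · simpa only [map_add, map_mul, map_pow, map_one, map_natCast, Polynomial.aeval_X,
      Polynomial.aeval_C, halg] using hunit
  · intro B _ _ φ ψ h
    refine AlgHom.coe_ringHom_injective (cloc_ringHom_ext k n d hd (fun p ↦ ?_) h)
    exact (φ.commutes p).trans (ψ.commutes p).symm
  · intro B _ _ b hb hbu
    simp only [map_sub, map_add, map_mul, map_pow, map_one, map_natCast, Polynomial.aeval_X,
      Polynomial.aeval_C] at hb hbu
    obtain ⟨φ, hφ, hφb⟩ := exists_cloc_lift k n d hd (algebraMap (PolyZY k d) B) b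
      (sub_eq_zero.mp hb) hbu
    exact ⟨{ φ with commutes' := hφ }, hφb⟩

theorem structHom_finitePresentation : (structHom k n d hd).toRingHom.FinitePresentation := by
  refine RingHom.FinitePresentation.of_finiteType.mp ?_
  have h : ((structHom k n d hd).toRingHom.comp (algebraMap k (PolyZY k d))).FiniteType := by
    have : (structHom k n d hd).toRingHom.comp (algebraMap k (PolyZY k d)) =
        algebraMap k (Cloc k n d hd) := (structHom k n d hd).comp_algebraMap
    rw [this, RingHom.finiteType_algebraMap]
    exact Algebra.FiniteType.trans (S := PolyTT k d) inferInstance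
      (IsLocalization.finiteType_of_monoid_fg (Submonoid.powers (clocDenom k n d hd)) _)
  exact RingHom.FiniteType.of_comp_finiteType h

/-!
STATEMENT 12.
Let `k` be a field, `n ≥ 2` and `d ≥ 1`, and let
`C = k[t₁,…,t_d,τ₁,…,τ_d][((1 + t₁^{n-1}τ₁)(1 + n·t₁^{n-1}τ₁))^{-1}]`.
Then the `k`-algebra homomorphism `k[z₁,…,z_d,y₁,…,y_d] → C` determined by
`z_i ↦ t_i + τ_i·t₁^n` and `y_i ↦ τ_i` is étale, i.e. (giving `C` the module/algebra
structure over the polynomial ring via this homomorphism) formally étale and of finite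
presentation.
-/
theorem stmt12 (hn : 2 ≤ n) (hd : 0 < d) :
    letI : Algebra (PolyZY k d) (Cloc k n d hd) :=
      (structHom k n d hd).toRingHom.toAlgebra
    Algebra.FormallyEtale (PolyZY k d) (Cloc k n d hd) ∧
      Algebra.FinitePresentation (PolyZY k d) (Cloc k n d hd) := by
  exact ⟨structHom_formallyEtale k n d hd, structHom_finitePresentation k n d hd⟩

end
end
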